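/- Let X be a set and let H ⊆ {0,1}^X have VC dimension at most d with d ≥ 1. Then for any positive integer n and any points x_1,…,x_n ∈ X, the empirical Rademacher average satisfies E_{σ ∼ Uniform({−1,+1}^n)}[ sup_{h ∈ H} (1/n)·∑_{i=1}^n σ_i·h(x_i) ] ≤ 31·√(d/n). -/

import Mathlib

/-- A class `G` of `{0,1}`-valued functions on `A` shatters the finite set `s` if every
`{0,1}` labeling of `s` is realized by some `g ∈ G`. -/
def Shatters01 {A : Type*} (G : Set (A → ℝ)) (s : Finset A) : Prop :=
  ∀ σ : A → Bool, ∃ g ∈ G, ∀ a ∈ s, g a = (if σ a then (1 : ℝ) else 0)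

open Finset

/-- The sum of the signs `σ i` over the coordinates `i` at which `a` is true. -/
noncomputable def signedSum {ι : Type*} [Fintype ι] (σ a : ι → Bool) : ℝ :=
  ∑ i, (if σ i then (1 : ℝ) else -1) * (if a i then (1 : ℝ) else 0)

theorem sum_exp_sign_sum_le {ι : Type*} [Fintype ι] [DecidableEq ι] (v : ι → ℝ) (r : ℝ) :
    ∑ σ : ι → Bool, Real.exp (r * ∑ i, (if σ i then (1 : ℝ) else -1) * v i)
      ≤ 2 ^ Fintype.card ι * Real.exp (r ^ 2 * (∑ i, v i ^ 2) / 2) := by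
  have h : ∀ σ : ι → Bool, Real.exp (r * ∑ i, (if σ i then (1 : ℝ) else -1) * v i)
      = ∏ i, Real.exp (r * ((if σ i then (1 : ℝ) else -1) * v i)) := fun σ => by
    rw [Finset.mul_sum, Real.exp_sum]
  have key := Finset.prod_univ_sum (fun _ : ι => (Finset.univ : Finset Bool))
    (fun i b => Real.exp (r * ((if b then (1 : ℝ) else -1) * v i)))
  rw [Fintype.piFinset_univ] at key
  rw [Finset.sum_congr rfl fun σ _ => h σ, ← key, Finset.mul_sum, Finset.sum_div, Real.exp_sum,
    ← Finset.card_univ, ← Finset.prod_const, ← Finset.prod_mul_distrib]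
  refine Finset.prod_le_prod (fun i _ => Finset.sum_nonneg fun b _ => (Real.exp_pos _).le)
    fun i _ => ?_
  have hc := Real.cosh_le_exp_half_sq (r * v i)
  rw [Real.cosh_eq] at hc
  simp only [Fintype.sum_bool, if_true, Bool.false_eq_true, if_false, one_mul, neg_mul, mul_neg]
  rw [mul_pow] at hc
  linarith

/-- **Massart's finite class lemma**: at most `exp u` sign sums with coefficient vectors of squared
norm at most `R` have a common upper bound of expectation at most `u / r + r * R / 2`. -/
theorem exists_bound_sign_sum {ι κ : Type*} [Fintype ι] [DecidableEq ι] (B : Finset κ)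
    (v : κ → ι → ℝ) {R u r : ℝ} (hr : 0 < r) (hv : ∀ a ∈ B, ∑ i, v a i ^ 2 ≤ R)
    (hB : (#B : ℝ) ≤ Real.exp u) :
    ∃ M : (ι → Bool) → ℝ,
      (∀ σ, ∀ a ∈ B, ∑ i, (if σ i then (1 : ℝ) else -1) * v a i ≤ M σ) ∧
      ∑ σ, M σ ≤ 2 ^ Fintype.card ι * (u / r + r * R / 2) := by
  set w : ℝ := u + r ^ 2 * R / 2 with hw
  set Z : (ι → Bool) → κ → ℝ := fun σ a => ∑ i, (if σ i then (1 : ℝ) else -1) * v a i with hZ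
  refine ⟨fun σ => (w - 1 + ∑ a ∈ B, Real.exp (r * Z σ a - w)) / r, fun σ a ha => ?_, ?_⟩
  · rw [le_div_iff₀ hr]
    have h1 := Real.add_one_le_exp (r * Z σ a - w)
    have h2 := Finset.single_le_sum (f := fun a => Real.exp (r * Z σ a - w))
      (fun a _ => (Real.exp_pos _).le) ha
    simp only [hZ] at h1 h2 ⊢
    linarith
  · have hsum : ∑ σ, ∑ a ∈ B, Real.exp (r * Z σ a - w) ≤ 2 ^ Fintype.card ι := by
      rw [Finset.sum_comm]
      calc ∑ a ∈ B, ∑ σ, Real.exp (r * Z σ a - w)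
          ≤ ∑ a ∈ B, 2 ^ Fintype.card ι * Real.exp (-u) := by
            refine Finset.sum_le_sum fun a ha => ?_
            simp_rw [Real.exp_sub, ← Finset.sum_div]
            rw [div_le_iff₀ (Real.exp_pos _), mul_assoc, ← Real.exp_add]
            refine (sum_exp_sign_sum_le (v a) r).trans ?_
            have := mul_le_mul_of_nonneg_left (hv a ha) (sq_nonneg r)
            gcongr
            rw [hw]
            linarith
        _ = 2 ^ Fintype.card ι * (#B * Real.exp (-u)) := by
            rw [Finset.sum_const, nsmul_eq_mul]; ring
        _ ≤ 2 ^ Fintype.card ι * 1 := by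
            gcongr
            rw [Real.exp_neg, ← div_eq_mul_inv]
            exact (div_le_one (Real.exp_pos _)).2 hB
        _ = _ := mul_one _
    rw [← Finset.sum_div, div_le_iff₀ hr, Finset.sum_add_distrib, Finset.sum_const,
      Finset.card_univ, Fintype.card_fun, Fintype.card_bool, nsmul_eq_mul]
    push_cast
    have : (2 : ℝ) ^ Fintype.card ι * (u / r + r * R / 2) * r = 2 ^ Fintype.card ι * w := by
      rw [hw]; field_simp
    rw [this]
    linarith

/-- The binomial form of the Sauer–Shelah lemma for labelings of a sequence of points. -/
theorem pow_mul_card_le_of_vc {X : Type*} {H : Set (X → ℝ)} {d : ℕ}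
    (hVC : ∀ s : Finset X, Shatters01 H s → #s ≤ d) {m : ℕ} (y : Fin m → X)
    (T : Finset (Fin m → Bool))
    (hT : ∀ a ∈ T, ∃ h ∈ H, ∀ i, h (y i) = if a i then (1 : ℝ) else 0)
    {t : ℝ} (ht : 0 ≤ t) (ht1 : t ≤ 1) : t ^ d * #T ≤ (1 + t) ^ m := by
  classical
  set F : Finset (Finset (Fin m)) := T.image fun a => univ.filter fun i => a i = true with hF
  have hcard : #F = #T := by
    refine Finset.card_image_of_injective _ fun a b hab => ?_
    ext i
    have := Finset.ext_iff.1 hab i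
    exact Bool.eq_iff_iff.2 (by simpa using this)
  have hdim : F.vcDim ≤ d := by
    rw [Finset.vcDim, Finset.sup_le_iff]
    intro s hs
    rw [Finset.mem_shatterer] at hs
    have hreal : ∀ u ⊆ s, ∃ h ∈ H, ∀ i ∈ s, h (y i) = if i ∈ u then (1 : ℝ) else 0 := by
      intro u hu
      obtain ⟨w, hw, hwu⟩ := hs hu
      obtain ⟨a, ha, rfl⟩ := Finset.mem_image.1 hw
      obtain ⟨h, hh, hy⟩ := hT a ha
      refine ⟨h, hh, fun i hi => ?_⟩
      rw [hy i, ← hwu]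
      simp [hi]
    have hinj : Set.InjOn y s := by
      intro i hi j hj hij
      by_contra hne
      obtain ⟨h, -, hy⟩ := hreal {i} (by simpa using hi)
      have h1 := hy i hi
      have h2 := hy j hj
      rw [← hij, h1] at h2
      simp [Ne.symm hne] at h2
    rw [← Finset.card_image_of_injOn hinj]
    refine hVC _ fun σ => ?_
    obtain ⟨h, hh, hy⟩ := hreal (s.filter fun i => σ (y i) = true) (Finset.filter_subset _ _)
    refine ⟨h, hh, fun a ha => ?_⟩
    obtain ⟨i, hi, rfl⟩ := Finset.mem_image.1 ha
    rw [hy i hi]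
    simp [hi]
  have hS : #T ≤ ∑ k ∈ Iic d, m.choose k := by
    rw [← hcard]
    refine (Finset.card_le_card_shatterer F).trans (Finset.card_shatterer_le_sum_vcDim.trans ?_)
    rw [Fintype.card_fin]
    exact Finset.sum_le_sum_of_subset (Finset.Iic_subset_Iic.2 hdim)
  calc t ^ d * #T ≤ t ^ d * ∑ k ∈ Iic d, (m.choose k : ℝ) := by
        gcongr
        exact_mod_cast hS
    _ ≤ ∑ k ∈ Iic d, t ^ k * (m.choose k : ℝ) := by
        rw [Finset.mul_sum]
        refine Finset.sum_le_sum fun k hk => ?_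
        exact mul_le_mul_of_nonneg_right (pow_le_pow_of_le_one ht ht1 (Finset.mem_Iic.1 hk))
          (Nat.cast_nonneg _)
    _ ≤ ∑ k ∈ range (d + m + 1), t ^ k * (m.choose k : ℝ) := by
        refine Finset.sum_le_sum_of_subset_of_nonneg (fun k hk => ?_) fun k _ _ => by positivity
        rw [Finset.mem_Iic] at hk
        rw [Finset.mem_range]
        omega
    _ = ∑ k ∈ range (m + 1), t ^ k * (m.choose k : ℝ) := by
        refine (Finset.sum_subset (fun k hk => ?_) fun k _ hk => ?_).symm
        · rw [Finset.mem_range] at *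
          omega
        · rw [Finset.mem_range] at hk
          rw [Nat.choose_eq_zero_of_lt (by omega), Nat.cast_zero, mul_zero]
    _ = (1 + t) ^ m := by
        rw [add_comm 1 t, add_pow]
        simp

/-- A random sample of coordinates distinguishes all members of a separated family. -/
theorem exists_sample_injOn {n m : ℕ} (B : Finset (Fin n → Bool)) {ε : ℝ} (hn : 0 < n)
    (hB : ∀ a ∈ B, ∀ b ∈ B, a ≠ b → ε * n < hammingDist a b)
    (hm : (#B : ℝ) ^ 2 * Real.exp (-(ε * m)) < 1) :
    ∃ f : Fin m → Fin n, Set.InjOn (fun a : Fin n → Bool => a ∘ f) B := by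
  classical
  by_contra! hcon
  set P : Finset ((Fin n → Bool) × (Fin n → Bool)) := (B ×ˢ B).filter fun p => p.1 ≠ p.2 with hP
  set G : (Fin n → Bool) × (Fin n → Bool) → Finset (Fin m → Fin n) := fun p =>
    Fintype.piFinset fun _ => univ.filter fun i => p.1 i = p.2 i with hG
  have hcover : (univ : Finset (Fin m → Fin n)) ⊆ P.biUnion G := by
    intro f _
    have := hcon f
    rw [Set.InjOn] at this
    push Not at this
    obtain ⟨a, ha, b, hb, hab, hne⟩ := this
    refine Finset.mem_biUnion.2 ⟨(a, b), by simp_all, ?_⟩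
    simp only [hG, Fintype.mem_piFinset, Finset.mem_filter, Finset.mem_univ, true_and]
    exact fun j => congrFun hab j
  have hGcard : ∀ p ∈ P, (#(G p) : ℝ) ≤ n ^ m * Real.exp (-(ε * m)) := by
    intro p hp
    simp only [hP, Finset.mem_filter, Finset.mem_product] at hp
    have hd := hB _ hp.1.1 _ hp.1.2 hp.2
    have hsplit := Finset.card_filter_add_card_filter_not
      (s := (univ : Finset (Fin n))) (fun i => p.1 i = p.2 i)
    rw [Finset.card_univ, Fintype.card_fin] at hsplit
    have hs' : (#(univ.filter fun i => p.1 i = p.2 i) : ℝ) + hammingDist p.1 p.2 = n := by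
      exact_mod_cast hsplit
    have hle : (#(univ.filter fun i => p.1 i = p.2 i) : ℝ) ≤ n * Real.exp (-ε) := by
      have h1 := Real.add_one_le_exp (-ε)
      have h2 : (n : ℝ) * (-ε + 1) ≤ n * Real.exp (-ε) := by gcongr
      linarith
    have hc : (#(G p) : ℝ) = (#(univ.filter fun i => p.1 i = p.2 i) : ℝ) ^ m := by
      simp [hG, Fintype.card_piFinset]
    rw [hc]
    calc _ ≤ ((n : ℝ) * Real.exp (-ε)) ^ m := by gcongr
      _ = _ := by
        rw [mul_pow, ← Real.exp_nat_mul]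
        ring_nf
  have hPcard : (#P : ℝ) ≤ (#B : ℝ) ^ 2 := by
    have : #P ≤ #B * #B := (Finset.card_filter_le _ _).trans (Finset.card_product _ _).le
    rw [sq]
    exact_mod_cast this
  have htot : ((n : ℝ) ^ m) ≤ ∑ p ∈ P, (#(G p) : ℝ) := by
    have := (Finset.card_le_card hcover).trans Finset.card_biUnion_le
    rw [Finset.card_univ, Fintype.card_fun, Fintype.card_fin, Fintype.card_fin] at this
    exact_mod_cast this
  have hup : ∑ p ∈ P, (#(G p) : ℝ) ≤ (#B : ℝ) ^ 2 * (n ^ m * Real.exp (-(ε * m))) := by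
    refine (Finset.sum_le_card_nsmul _ _ _ hGcard).trans ?_
    rw [nsmul_eq_mul]
    gcongr
  have hnm : (0 : ℝ) < (n : ℝ) ^ m := by positivity
  nlinarith

/-- **Packing bound**: a family of labelings from a class of VC dimension at most `d` whose
members are at pairwise relative Hamming distance more than `ε` has at most
`exp (1 / 2) * (4 / ε) ^ (2 * d)` members. -/
theorem card_le_of_vc_of_separated {X : Type*} {H : Set (X → ℝ)} {d : ℕ}
    (hVC : ∀ s : Finset X, Shatters01 H s → #s ≤ d) {n : ℕ} (hn : 0 < n) (x : Fin n → X)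
    (B : Finset (Fin n → Bool))
    (hBH : ∀ a ∈ B, ∃ h ∈ H, ∀ i, h (x i) = if a i then (1 : ℝ) else 0)
    {ε : ℝ} (hε : 0 < ε) (hε1 : ε ≤ 1)
    (hB : ∀ a ∈ B, ∀ b ∈ B, a ≠ b → ε * n < hammingDist a b) :
    (#B : ℝ) ≤ Real.exp (1 / 2) * (4 / ε) ^ (2 * d) := by
  classical
  rcases B.eq_empty_or_nonempty with rfl | hne
  · simp only [Finset.card_empty, Nat.cast_zero]
    positivity
  have hN : (1 : ℝ) ≤ #B := by exact_mod_cast hne.card_pos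
  have hN0 : (0 : ℝ) < #B := by linarith
  set L := Real.log #B with hL
  have hL0 : 0 ≤ L := Real.log_nonneg hN
  have hexp : Real.exp L = #B := Real.exp_log hN0
  set m := ⌊2 * L / ε⌋₊ + 1 with hm
  have hm1 : 2 * L < ε * m := by
    have := Nat.lt_floor_add_one (2 * L / ε)
    rw [div_lt_iff₀ hε] at this
    rw [hm]
    push_cast
    linarith
  have hm2 : ε * m ≤ 2 * L + ε := by
    have := Nat.floor_le (show 0 ≤ 2 * L / ε by positivity)
    rw [le_div_iff₀ hε] at this
    rw [hm]
    push_cast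
    linarith
  obtain ⟨f, hf⟩ := exists_sample_injOn (m := m) B hn hB (by
    rw [← hexp, ← Real.exp_nat_mul, ← Real.exp_add, Real.exp_lt_one_iff]
    push_cast
    linarith)
  have hS := pow_mul_card_le_of_vc hVC (x ∘ f) (B.image fun a => a ∘ f) (by
    intro a ha
    obtain ⟨b, hb, rfl⟩ := Finset.mem_image.1 ha
    obtain ⟨h, hh, hx⟩ := hBH b hb
    exact ⟨h, hh, fun i => hx (f i)⟩) (t := ε / 4) (by positivity) (by linarith)
  rw [Finset.card_image_of_injOn hf] at hS
  have hS' : (ε / 4) ^ d * #B ≤ Real.exp (L / 2 + 1 / 4) := by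
    refine hS.trans ?_
    calc (1 + ε / 4) ^ m ≤ Real.exp (ε / 4) ^ m := by
          gcongr
          linarith [Real.add_one_le_exp (ε / 4)]
      _ = Real.exp (m * (ε / 4)) := (Real.exp_nat_mul _ _).symm
      _ ≤ _ := by
          gcongr
          linarith
  have hsq : ((ε / 4) ^ d * #B) ^ 2 ≤ Real.exp (1 / 2) * #B := by
    calc _ ≤ Real.exp (L / 2 + 1 / 4) ^ 2 := by gcongr
      _ = _ := by
        rw [← hexp, ← Real.exp_nat_mul, ← Real.exp_add]
        congr 1
        push_cast
        ring
  have hfin : (ε / 4) ^ (2 * d) * #B ≤ Real.exp (1 / 2) := by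
    refine le_of_mul_le_mul_right ?_ hN0
    calc _ = ((ε / 4) ^ d * #B) ^ 2 := by ring
      _ ≤ _ := hsq
  have hinv : (4 / ε) ^ (2 * d) = ((ε / 4) ^ (2 * d))⁻¹ := by
    rw [← inv_pow, inv_div]
  rw [hinv, ← div_eq_mul_inv, le_div_iff₀ (by positivity)]
  linarith

theorem card_le_exp_of_vc_of_separated {X : Type*} {H : Set (X → ℝ)} {d : ℕ} (hd : 1 ≤ d)
    (hVC : ∀ s : Finset X, Shatters01 H s → #s ≤ d) {n : ℕ} (hn : 0 < n) (x : Fin n → X)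
    (B : Finset (Fin n → Bool))
    (hBH : ∀ a ∈ B, ∃ h ∈ H, ∀ i, h (x i) = if a i then (1 : ℝ) else 0) (k : ℕ)
    (hB : ∀ a ∈ B, ∀ b ∈ B, a ≠ b → (n : ℝ) / 4 ^ (k + 1) < hammingDist a b) :
    (#B : ℝ) ≤ Real.exp (7 * (k + 1) * d) := by
  have h := card_le_of_vc_of_separated hVC hn x B hBH (ε := 1 / 4 ^ (k + 1)) (by positivity)
    (by
      rw [div_le_one (by positivity)]
      exact one_le_pow₀ (by norm_num))
    (fun a ha b hb hab => by
      have := hB a ha b hb hab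
      rwa [one_div_mul_eq_div])
  refine h.trans ?_
  have h4 : (4 : ℝ) / (1 / 4 ^ (k + 1)) = 4 ^ (k + 2) := by
    field_simp
    ring
  have hlog : Real.log 4 ≤ 3 / 2 := by
    rw [show (4 : ℝ) = 2 ^ 2 by norm_num, Real.log_pow]
    push_cast
    linarith [Real.log_two_lt_d9]
  have h4e : (4 : ℝ) ≤ Real.exp (3 / 2) := (Real.log_le_iff_le_exp (by norm_num)).1 hlog
  have hd' : (1 : ℝ) ≤ d := by exact_mod_cast hd
  rw [h4, ← pow_mul]
  calc Real.exp (1 / 2) * (4 : ℝ) ^ ((k + 2) * (2 * d))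
      ≤ Real.exp (1 / 2) * Real.exp (3 / 2) ^ ((k + 2) * (2 * d)) := by gcongr
    _ = Real.exp (1 / 2 + (k + 2) * (2 * d) * (3 / 2)) := by
        rw [← Real.exp_nat_mul, ← Real.exp_add]
        push_cast
        rfl
    _ ≤ _ := by
        gcongr
        nlinarith [mul_nonneg (Nat.cast_nonneg (α := ℝ) k) (Nat.cast_nonneg (α := ℝ) d)]

/-- Every finite family of labelings contains a separated subfamily which is a net for it. -/
theorem exists_separated_net {ι : Type*} [Fintype ι] [DecidableEq ι] (B : Finset (ι → Bool))
    {δ : ℝ} (hδ : 0 ≤ δ) :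
    ∃ C ⊆ B, (∀ a ∈ C, ∀ b ∈ C, a ≠ b → δ < hammingDist a b) ∧
      ∀ a ∈ B, ∃ b ∈ C, (hammingDist a b : ℝ) ≤ δ := by
  classical
  obtain ⟨C, hC, hmax⟩ := Finset.exists_max_image
    (B.powerset.filter fun C => ∀ a ∈ C, ∀ b ∈ C, a ≠ b → δ < hammingDist a b) Finset.card
    ⟨∅, by simp⟩
  rw [Finset.mem_filter, Finset.mem_powerset] at hC
  refine ⟨C, hC.1, hC.2, fun a ha => ?_⟩
  by_contra! hfar
  have haC : a ∉ C := fun h => by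
    have := hfar a h
    rw [hammingDist_self, Nat.cast_zero] at this
    linarith
  have := hmax (insert a C) (by
    rw [Finset.mem_filter, Finset.mem_powerset]
    refine ⟨Finset.insert_subset ha hC.1, fun b hb c hc hbc => ?_⟩
    rcases Finset.mem_insert.1 hb with rfl | hb' <;> rcases Finset.mem_insert.1 hc with rfl | hc'
    · exact absurd rfl hbc
    · exact hfar c hc'
    · rw [hammingDist_comm]
      exact hfar b hb'
    · exact hC.2 b hb' c hc' hbc)
  rw [Finset.card_insert_of_notMem haC] at this
  omega

theorem sum_signedSum {ι : Type*} [Fintype ι] [DecidableEq ι] (a : ι → Bool) :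
    ∑ σ : ι → Bool, signedSum σ a = 0 := by
  have h : ∑ σ : ι → Bool, signedSum σ a = ∑ σ : ι → Bool, signedSum (fun i => !σ i) a :=
    (Fintype.sum_equiv (Equiv.piCongrRight fun _ => Equiv.boolNot) _ _ fun σ => rfl).symm
  have hneg : ∀ σ : ι → Bool, signedSum (fun i => !σ i) a = -signedSum σ a := fun σ => by
    rw [signedSum, signedSum, ← Finset.sum_neg_distrib]
    refine Finset.sum_congr rfl fun i _ => ?_
    cases σ i <;> cases a i <;> simp
  simp_rw [hneg, Finset.sum_neg_distrib] at h
  linarith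

/-- **Chaining**: the sign sums over a family at separation `n / 4 ^ k` have a common upper bound
with expectation of order `√(d * n)`, uniformly in `k`. -/
theorem exists_bound_signedSum_of_separated {X : Type*} {H : Set (X → ℝ)} {d : ℕ} (hd : 1 ≤ d)
    (hVC : ∀ s : Finset X, Shatters01 H s → #s ≤ d) {n : ℕ} (hn : 0 < n) (x : Fin n → X)
    (k : ℕ) (B : Finset (Fin n → Bool))
    (hBH : ∀ a ∈ B, ∃ h ∈ H, ∀ i, h (x i) = if a i then (1 : ℝ) else 0)
    (hB : ∀ a ∈ B, ∀ b ∈ B, a ≠ b → (n : ℝ) / 4 ^ k < hammingDist a b) :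
    ∃ M : (Fin n → Bool) → ℝ, (∀ σ, ∀ a ∈ B, signedSum σ a ≤ M σ) ∧
      ∑ σ, M σ ≤ 2 ^ n * (Real.sqrt (d * n) * (4 * (4 - (2 * k + 4) / 2 ^ k))) := by
  induction k generalizing B with
  | zero =>
    rcases B.eq_empty_or_nonempty with rfl | ⟨a, ha⟩
    · exact ⟨fun _ => 0, by simp, by simp⟩
    · refine ⟨fun σ => signedSum σ a, fun σ b hb => ?_, ?_⟩
      · have : b = a := by
          by_contra hne
          have h1 := hB b hb a ha hne
          have h2 : (hammingDist b a : ℝ) ≤ n := by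
            have := hammingDist_le_card_fintype (x := b) (y := a)
            rw [Fintype.card_fin] at this
            exact_mod_cast this
          simp only [pow_zero, div_one] at h1
          linarith
        rw [this]
      · rw [sum_signedSum]
        norm_num
  | succ k ih =>
    obtain ⟨C, hCB, hCsep, hnet⟩ := exists_separated_net B (δ := (n : ℝ) / 4 ^ k) (by positivity)
    obtain ⟨M, hM, hMsum⟩ := ih C (fun a ha => hBH a (hCB ha)) hCsep
    choose! p hpC hp using hnet
    have hd0 : (0 : ℝ) < d := by exact_mod_cast hd
    have hn0 : (0 : ℝ) < n := by exact_mod_cast hn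
    set s := Real.sqrt (d * n) with hs
    have hs0 : 0 < s := Real.sqrt_pos.2 (by positivity)
    have hss : s * s = d * n := Real.mul_self_sqrt (by positivity)
    obtain ⟨D, hD, hDsum⟩ := exists_bound_sign_sum (R := (n : ℝ) / 4 ^ k)
      (u := 7 * (k + 1) * d) (r := 4 * s / n * 2 ^ k) B
      (fun a i => (if a i then (1 : ℝ) else 0) - (if p a i then (1 : ℝ) else 0))
      (by positivity)
      (fun a ha => by
        refine le_trans (le_of_eq ?_) (hp a ha)
        rw [hammingDist, Finset.card_filter]
        push_cast
        refine Finset.sum_congr rfl fun i _ => ?_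
        cases a i <;> cases p a i <;> simp)
      (card_le_exp_of_vc_of_separated hd hVC hn x B hBH k hB)
    refine ⟨fun σ => M σ + D σ, fun σ a ha => ?_, ?_⟩
    · have h1 := hM σ (p a) (hpC a ha)
      have h2 := hD σ a ha
      simp_rw [mul_sub, Finset.sum_sub_distrib] at h2
      simp only [signedSum] at h1 ⊢
      linarith
    · rw [Finset.sum_add_distrib]
      rw [Fintype.card_fin] at hDsum
      refine (add_le_add hMsum hDsum).trans ?_
      rw [← mul_add]
      gcongr
      have hu : 7 * ((k : ℝ) + 1) * d / (4 * s / n * 2 ^ k) = 7 / 4 * (k + 1) * s / 2 ^ k := by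
        field_simp
        linear_combination -hss
      have hr : 4 * s / n * 2 ^ k * ((n : ℝ) / 4 ^ k) / 2 = 2 * s / 2 ^ k := by
        rw [show (4 : ℝ) ^ k = 2 ^ k * 2 ^ k by rw [← mul_pow]; norm_num]
        field_simp
        ring
      rw [hu, hr]
      have hrhs : s * (4 * (4 - (2 * ((k + 1 : ℕ) : ℝ) + 4) / 2 ^ (k + 1)))
          - s * (4 * (4 - (2 * (k : ℝ) + 4) / 2 ^ k)) = 4 * (k + 1) * s / 2 ^ k := by
        rw [pow_succ]
        push_cast
        field_simp
        ring
      have hcmp : 7 / 4 * ((k : ℝ) + 1) * s / 2 ^ k + 2 * s / 2 ^ k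
          ≤ 4 * (k + 1) * s / 2 ^ k := by
        rw [← add_div]
        gcongr
        nlinarith [mul_nonneg (Nat.cast_nonneg (α := ℝ) k) hs0.le]
      linarith

/-- **Rademacher complexity of a VC class (Lemma C.1).**
For a class `H` of `{0,1}`-valued functions of VC dimension at most `d ≥ 1` and
any points `x₁, …, xₙ`, the empirical Rademacher average satisfies
`E_σ[sup_{h ∈ H} (1/n)·∑ σᵢ·h(xᵢ)] ≤ 31·√(d/n)`. -/
theorem rademacher_vc_bound {X : Type*} (H : Set (X → ℝ))
    (hH01 : ∀ h ∈ H, ∀ x, h x = 0 ∨ h x = 1)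
    (d : ℕ) (hd : 1 ≤ d)
    (hVC : ∀ s : Finset X, Shatters01 H s → s.card ≤ d)
    (n : ℕ) (hn : 0 < n) (x : Fin n → X) :
    (1 / 2 ^ n : ℝ) * ∑ σ : Fin n → Bool,
        sSup ((fun h : X → ℝ =>
          (1 / n : ℝ) * ∑ i, (if σ i then (1 : ℝ) else -1) * h (x i)) '' H)
      ≤ 31 * Real.sqrt (d / n) := by
  classical
  have hn0 : (0 : ℝ) < n := by exact_mod_cast hn
  rcases H.eq_empty_or_nonempty with rfl | hne
  · simp only [Set.image_empty, Real.sSup_empty, Finset.sum_const_zero, mul_zero]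
    positivity
  set A : Finset (Fin n → Bool) :=
    univ.filter fun a => ∃ h ∈ H, ∀ i, h (x i) = if a i then (1 : ℝ) else 0 with hA
  obtain ⟨M, hM, hMsum⟩ := exists_bound_signedSum_of_separated hd hVC hn x n A
    (fun a ha => (Finset.mem_filter.1 ha).2) (fun a _ b _ hab => by
      have h1 : (1 : ℝ) ≤ hammingDist a b := by exact_mod_cast hammingDist_pos.2 hab
      refine lt_of_lt_of_le ?_ h1
      rw [div_lt_one (by positivity)]
      exact_mod_cast Nat.lt_pow_self (by norm_num : 1 < 4))
  have hsup : ∀ σ : Fin n → Bool, sSup ((fun h : X → ℝ =>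
      (1 / n : ℝ) * ∑ i, (if σ i then (1 : ℝ) else -1) * h (x i)) '' H) ≤ 1 / n * M σ := by
    intro σ
    refine csSup_le (hne.image _) ?_
    rintro _ ⟨h, hh, rfl⟩
    have hval : ∀ i, h (x i) = if decide (h (x i) = 1) then (1 : ℝ) else 0 := fun i => by
      rcases hH01 h hh (x i) with h0 | h1
      · simp [h0]
      · simp [h1]
    have := hM σ (fun i => decide (h (x i) = 1))
      (Finset.mem_filter.2 ⟨Finset.mem_univ _, h, hh, hval⟩)
    have heq : signedSum σ (fun i => decide (h (x i) = 1))
        = ∑ i, (if σ i then (1 : ℝ) else -1) * h (x i) :=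
      Finset.sum_congr rfl fun i _ => by rw [← hval i]
    rw [heq] at this
    exact mul_le_mul_of_nonneg_left this (by positivity)
  have hsqrt : Real.sqrt (d * n) = n * Real.sqrt (d / n) := by
    rw [show (d * n : ℝ) = n ^ 2 * (d / n) by field_simp, Real.sqrt_mul (by positivity),
      Real.sqrt_sq hn0.le]
  calc _ ≤ (1 / 2 ^ n : ℝ) * ∑ σ : Fin n → Bool, 1 / n * M σ := by
        gcongr with σ
        exact hsup σ
    _ = (1 / 2 ^ n : ℝ) * (1 / n * ∑ σ, M σ) := by rw [← Finset.mul_sum]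
    _ ≤ (1 / 2 ^ n : ℝ) * (1 / n *
          (2 ^ n * (Real.sqrt (d * n) * (4 * (4 - (2 * n + 4) / 2 ^ n))))) := by gcongr
    _ = Real.sqrt (d / n) * (4 * (4 - (2 * n + 4) / 2 ^ n)) := by
        rw [hsqrt]
        field_simp
    _ ≤ Real.sqrt (d / n) * 31 := by
        gcongr
        have : (0 : ℝ) ≤ (2 * n + 4) / 2 ^ n := by positivity
        linarith
    _ = _ := mul_comm _ _
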